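/- arXiv:2004.13153 — 7 statements merged into one kernel-verified Lean document; each statement's English description precedes it below -/
import Mathlib

section
/- Let k, n ≥ 1, let 0 ≤ d_1 ≤ d_2 ≤ … ≤ d_n be reals, and let ρ_1, …, ρ_n ≥ 0 with Σ_{i=1}^n ρ_i = 1. For each i define P_i = Σ_{j=i+1}^n ρ_j. Then Σ_{i=1}^n d_i^k · ((P_i + ρ_i)^k − P_i^k) ≤ (Σ_{i=1}^n d_i ρ_i)^k. -/
/-- On the nonnegative reals, the increments `(x + a) ^ k - x ^ k` are nondecreasing in `x`. -/
lemma add_pow_sub_pow_le {x y a : ℝ} (hx : 0 ≤ x) (hxy : x ≤ y) (ha : 0 ≤ a) (k : ℕ) :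
    (x + a) ^ k - x ^ k ≤ (y + a) ^ k - y ^ k := by
  induction k with
  | zero => simp
  | succ k ih =>
    have h0 : 0 ≤ (x + a) ^ k - x ^ k :=
      sub_nonneg.2 (pow_le_pow_left₀ hx (by linarith) k)
    have h1 : (x + a) * ((x + a) ^ k - x ^ k) ≤ (y + a) * ((y + a) ^ k - y ^ k) :=
      mul_le_mul (by linarith) ih h0 (by linarith)
    have h2 : a * x ^ k ≤ a * y ^ k :=
      mul_le_mul_of_nonneg_left (pow_le_pow_left₀ hx hxy k) ha
    calc (x + a) ^ (k + 1) - x ^ (k + 1)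
        = (x + a) * ((x + a) ^ k - x ^ k) + a * x ^ k := by ring
      _ ≤ (y + a) * ((y + a) ^ k - y ^ k) + a * y ^ k := add_le_add h1 h2
      _ = (y + a) ^ (k + 1) - y ^ (k + 1) := by ring

/-- The inequality for weights of arbitrary total mass, with the tail weights written out. -/
lemma sum_pow_mul_tail_pow_sub_le {k : ℕ} (hk : k ≠ 0) (n : ℕ) (d ρ : Fin n → ℝ)
    (hd0 : ∀ i, 0 ≤ d i) (hdmono : Monotone d) (hρ0 : ∀ i, 0 ≤ ρ i) :
    ∑ i, d i ^ k * (((∑ j with i < j, ρ j) + ρ i) ^ k - (∑ j with i < j, ρ j) ^ k)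
      ≤ (∑ i, d i * ρ i) ^ k := by
  induction n with
  | zero => simp [hk]
  | succ n ih =>
    have htail := ih (fun i => d i.succ) (fun i => ρ i.succ) (fun i => hd0 _)
      (fun i j hij => hdmono (Fin.succ_le_succ_iff.2 hij)) (fun i => hρ0 _)
    have hle : d 0 * ∑ i : Fin n, ρ i.succ ≤ ∑ i : Fin n, d i.succ * ρ i.succ := by
      rw [Finset.mul_sum]
      exact Finset.sum_le_sum fun i _ =>
        mul_le_mul_of_nonneg_right (hdmono (Fin.zero_le _)) (hρ0 _)
    have hinc := add_pow_sub_pow_le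
      (mul_nonneg (hd0 0) (Finset.sum_nonneg fun (i : Fin n) _ => hρ0 i.succ)) hle
      (mul_nonneg (hd0 0) (hρ0 0)) k
    rw [← mul_add, mul_pow, mul_pow, ← mul_sub] at hinc
    simp only [Finset.sum_filter] at htail ⊢
    simp only [Fin.sum_univ_succ (n := n), Fin.succ_lt_succ_iff, Fin.succ_pos,
      Fin.not_lt_zero, if_true, if_false, zero_add]
    rw [add_comm (d 0 * ρ 0)]
    linarith

/-- The purely algebraic core of Lemma 1: for a finitely supported distribution
with nondecreasing nonnegative support values `d` and weights `ρ` summing to 1,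
with tail weights `P i = Σ_{j>i} ρ j`, we have
`Σ_i d_i^k ((P_i + ρ_i)^k − P_i^k) ≤ (Σ_i d_i ρ_i)^k`. -/
theorem sum_pow_tail_le_mean_pow
    (k n : ℕ) (hk : 1 ≤ k) (hn : 1 ≤ n)
    (d ρ : Fin n → ℝ)
    (hd0 : ∀ i, 0 ≤ d i)
    (hdmono : Monotone d)
    (hρ0 : ∀ i, 0 ≤ ρ i)
    (hρsum : ∑ i, ρ i = 1)
    (P : Fin n → ℝ)
    (hP : ∀ i, P i = ∑ j ∈ Finset.univ.filter (fun j => i < j), ρ j) :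
    ∑ i, d i ^ k * ((P i + ρ i) ^ k - P i ^ k) ≤ (∑ i, d i * ρ i) ^ k := by
  simp only [hP]
  exact sum_pow_mul_tail_pow_sub_le (by omega) n d ρ hd0 hdmono hρ0
end

section
/- (Full-participation sampling lower bound, Theorem 1 instance.) Fix integers n ≥ 1, k ≥ 2, and 0 ≤ a ≤ n with α = a/n ∈ [1/2, 1). Consider two alternatives A and B at distance 1 in a metric space, and n voters of whom a are located at A and n − a are located at B, so the per-voter social cost of A is 1 − α and of B is α, and A is optimal. Let a sample consist of k − 1 voters drawn independently and uniformly at random with replacement; the favorite alternative of a voter is the alternative at its location. Then for ANY (possibly randomized) mechanism whose output on every sample is supported on the set of favorite alternatives of the sampled voters, the expected k-th power of the social cost of the output is at least (1 − α)^{k−1} · α^k; consequently the normalized k-th moment of Distortion, defined as (E[SC(output)^k])^{1/k} / SC(A), is at least α / (1 − α)^{1/k}. -/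
/-- The indicator of `f i ≠ c` sums to the number of indices outside the fiber over `c`. -/
theorem sum_ite_zero_one_eq_card_ne {ι : Type*} [Fintype ι] (f : ι → Bool) (c : Bool) :
    ∑ i, (if f i = c then (0 : ℝ) else 1) =
      ((Finset.univ.filter (fun i => f i = !c)).card : ℝ) := by
  rw [Finset.card_filter, Nat.cast_sum]
  refine Finset.sum_congr rfl fun i _ => ?_
  cases f i <;> cases c <;> simp

/-- If `f` is nonnegative and equal to `x` on all tuples with entries in `S`, then its total sum
is at least `|S| ^ m * x`. -/
theorem card_pow_mul_le_sum_of_eq_on_tuples {ι : Type*} [Fintype ι] [DecidableEq ι] {m : ℕ}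
    (S : Finset ι) (f : (Fin m → ι) → ℝ) (x : ℝ) (hf : ∀ s, 0 ≤ f s)
    (hx : ∀ s, (∀ j, s j ∈ S) → f s = x) :
    (S.card : ℝ) ^ m * x ≤ ∑ s, f s := by
  calc (S.card : ℝ) ^ m * x = ∑ s ∈ Fintype.piFinset (fun _ : Fin m => S), f s := by
        rw [Finset.sum_congr rfl fun s hs => hx s (Fintype.mem_piFinset.mp hs)]
        simp
    _ ≤ ∑ s, f s :=
        Finset.sum_le_sum_of_subset_of_nonneg (Finset.subset_univ _) fun s _ _ => hf s

/-- A lower bound `β ^ (k - 1) * α ^ k` on a `k`-th moment bounds its normalized `k`-th root. -/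
theorem div_rpow_le_rpow_div_of_pow_mul_pow_le {α β E : ℝ} {k : ℕ} (hk : k ≠ 0)
    (hα : 0 ≤ α) (hβ : 0 < β) (hE : β ^ (k - 1) * α ^ k ≤ E) :
    α / β ^ ((1 : ℝ) / k) ≤ E ^ ((1 : ℝ) / k) / β := by
  have hE0 : 0 ≤ E := le_trans (by positivity) hE
  rw [le_div_iff₀ hβ, one_div]
  refine le_of_pow_le_pow_left₀ hk (by positivity) ?_
  rw [Real.rpow_inv_natCast_pow hE0 hk, mul_pow, div_pow, Real.rpow_inv_natCast_pow hβ.le hk]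
  refine le_of_eq_of_le ?_ hE
  rw [← pow_sub_one_mul hk β]
  field_simp


/-- Theorem 1 instance (full participation lower bound). Two alternatives `A`
(encoded `true`) and `B` (encoded `false`) at distance 1; `a` of the `n` voters
are located at `A` and the rest at `B`, with `α = a/n ∈ [1/2, 1)`. Samples are
tuples of `k−1` voters drawn uniformly with replacement. Any randomized
mechanism `mech` whose output is supported on the favorite alternatives (the
locations) of the sampled voters has expected k-th power of social cost at
least `(1−α)^{k−1} α^k`, and hence normalized k-th moment of Distortion at
least `α/(1−α)^{1/k}`. -/
theorem full_participation_lower_bound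
    (n k a : ℕ) (hn : 1 ≤ n) (hk : 2 ≤ k) (han : a ≤ n)
    (α : ℝ) (hα : α = (a : ℝ) / n) (hhalf : 1 / 2 ≤ α) (h1 : α < 1)
    (loc : Fin n → Bool)
    (hcard : (Finset.univ.filter (fun i => loc i = true)).card = a)
    (SC : Bool → ℝ)
    (hSC : ∀ c, SC c = (1 / (n : ℝ)) * ∑ i, (if loc i = c then (0 : ℝ) else 1))
    (mech : (Fin (k - 1) → Fin n) → Bool → ℝ)
    (hpos : ∀ s c, 0 ≤ mech s c)
    (hsum : ∀ s, ∑ c, mech s c = 1)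
    (hsupp : ∀ s c, mech s c ≠ 0 → ∃ j, loc (s j) = c) :
    (1 - α) ^ (k - 1) * α ^ k ≤
      (1 / (n : ℝ) ^ (k - 1)) *
        ∑ s : Fin (k - 1) → Fin n, ∑ c, mech s c * SC c ^ k
    ∧ α / (1 - α) ^ ((1 : ℝ) / k) ≤
      ((1 / (n : ℝ) ^ (k - 1)) *
        ∑ s : Fin (k - 1) → Fin n, ∑ c, mech s c * SC c ^ k) ^ ((1 : ℝ) / k)
        / SC true := by
  have hn0 : (0 : ℝ) < n := by exact_mod_cast hn
  have hcardB : (((Finset.univ.filter (fun i => loc i = false)).card : ℕ) : ℝ) = n - a := by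
    have h := Finset.card_filter_add_card_filter_not (s := Finset.univ) (fun i => loc i = true)
    simp only [hcard, Bool.not_eq_true, Finset.card_univ, Fintype.card_fin] at h
    rw [eq_sub_iff_add_eq']
    exact_mod_cast h
  have hα' : (n : ℝ) - a = n * (1 - α) := by rw [hα]; field_simp
  have hSCA : SC true = 1 - α := by
    rw [hSC, sum_ite_zero_one_eq_card_ne, Bool.not_true, hcardB, hα']
    field_simp
  have hSCB : SC false = α := by
    rw [hSC, sum_ite_zero_one_eq_card_ne, Bool.not_false, hcard, hα]
    field_simp
  have hβ : 0 < 1 - α := sub_pos.mpr h1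
  have hα0 : 0 ≤ α := by linarith
  have hSC0 : ∀ c, 0 ≤ SC c := Bool.forall_bool.mpr ⟨hSCB ▸ hα0, hSCA ▸ hβ.le⟩
  have hmoment : (1 - α) ^ (k - 1) * α ^ k ≤
      (1 / (n : ℝ) ^ (k - 1)) *
        ∑ s : Fin (k - 1) → Fin n, ∑ c, mech s c * SC c ^ k := by
    have h := card_pow_mul_le_sum_of_eq_on_tuples
      (Finset.univ.filter (fun i => loc i = false))
      (fun s : Fin (k - 1) → Fin n => ∑ c, mech s c * SC c ^ k) (α ^ k)
      (fun s => Finset.sum_nonneg fun c _ => mul_nonneg (hpos s c) (pow_nonneg (hSC0 c) k))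
      (fun s hs => by
        have hA : mech s true = 0 := by
          by_contra hne
          obtain ⟨j, hj⟩ := hsupp s true hne
          simpa [hj] using hs j
        have hB : mech s false = 1 := by simpa [hA] using hsum s
        simp [hA, hB, hSCB])
    rw [hcardB, hα', mul_pow, mul_assoc] at h
    rwa [one_div, ← div_eq_inv_mul, le_div_iff₀' (by positivity)]
  refine ⟨hmoment, ?_⟩
  rw [hSCA]
  exact div_rpow_le_rpow_div_of_pow_mul_pow_le (by lia) hα0 hβ hmoment
end

section
/- (Limited-participation sampling lower bound, Theorem 3 instance.) Fix integers n ≥ 1, k ≥ 1, and 0 ≤ a ≤ n with α = a/n ∈ [1/2, 1). Consider two alternatives A and B at distance 1 in a metric space, and n voters of whom a are located at A and n − a are located at B, so the per-voter social cost of A is 1 − α and of B is α, and A is optimal. Let a sample consist of 2k − 2 voters drawn independently and uniformly at random with replacement. Then for any (possibly randomized) mechanism which, on every sample in which exactly k − 1 sampled voters are located at A and exactly k − 1 are located at B, outputs B with probability at least 1/2, the expected k-th power of the social cost of the output is at least (1/2) · (1 − α)^{k−1} · α^k; consequently the normalized k-th moment of Distortion, defined as (E[SC(output)^k])^{1/k}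 / SC(A), is at least α / (2 · (1 − α)^{1/k}). -/
/-- The number of tuples having exactly `m` entries of the class `p = true`. -/
theorem card_filter_card_filter_eq {ι β : Type*} [Fintype ι] [DecidableEq ι] [Fintype β]
    [DecidableEq β] (p : β → Bool) (m : ℕ) :
    (Finset.univ.filter (fun s : ι → β =>
      (Finset.univ.filter (fun j => p (s j) = true)).card = m)).card =
    (Fintype.card ι).choose m * ((Finset.univ.filter (fun i => p i = true)).card ^ m *
      (Finset.univ.filter (fun i => p i = false)).card ^ (Fintype.card ι - m)) := by
  rw [Finset.card_eq_sum_card_fiberwise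
    (f := fun s : ι → β => Finset.univ.filter (fun j => p (s j) = true))
    (t := Finset.powersetCard m Finset.univ)]
  · rw [Finset.sum_congr rfl (g := fun _ => (Finset.univ.filter (fun i => p i = true)).card ^ m *
      (Finset.univ.filter (fun i => p i = false)).card ^ (Fintype.card ι - m))]
    · simp
    · intro T hT
      have hTm : T.card = m := (Finset.mem_powersetCard.mp hT).2
      have hfiber : (Finset.univ.filter (fun s : ι → β =>
            (Finset.univ.filter (fun j => p (s j) = true)).card = m)).filter
            (fun s => Finset.univ.filter (fun j => p (s j) = true) = T) =
          Fintype.piFinset (fun j => if j ∈ T then Finset.univ.filter (fun i => p i = true)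
            else Finset.univ.filter (fun i => p i = false)) := by
        ext s
        simp only [Finset.mem_filter, Finset.mem_univ, true_and, Fintype.mem_piFinset]
        constructor
        · rintro ⟨-, rfl⟩ j
          by_cases h : p (s j) = true <;> simp [h]
        · intro h
          have hs : Finset.univ.filter (fun j => p (s j) = true) = T := by
            ext j
            have := h j
            by_cases hj : j ∈ T <;> simp_all
          exact ⟨hs ▸ hTm, hs⟩
      rw [hfiber, Fintype.card_piFinset, ← hTm, ← Finset.card_compl]
      simp only [apply_ite Finset.card]
      rw [Finset.prod_ite]
      simp [Finset.filter_not, Finset.compl_eq_univ_sdiff]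
  · intro s hs
    simpa using hs

/-- A balanced outcome of `2 * m` Bernoulli trials with success probability at least `1 / 2` has
probability at least `(1 - α) ^ m`. -/
theorem one_sub_pow_le_centralBinom_mul {α : ℝ} (hhalf : 1 / 2 ≤ α) (h1 : α ≤ 1) (m : ℕ) :
    (1 - α) ^ m ≤ (m.centralBinom : ℝ) * (α ^ m * (1 - α) ^ m) := by
  have hc : (2 : ℝ) ^ m ≤ m.centralBinom := by
    induction m with
    | zero => simp
    | succ m ih =>
      have h : ((m : ℝ) + 1) * (m + 1).centralBinom = 2 * (2 * m + 1) * m.centralBinom := by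
        exact_mod_cast Nat.succ_mul_centralBinom_succ m
      have hm : (0 : ℝ) < m + 1 := by positivity
      have hb : (0 : ℝ) ≤ m.centralBinom := by positivity
      refine le_of_mul_le_mul_left ?_ hm
      rw [h, pow_succ]
      nlinarith [mul_nonneg (Nat.cast_nonneg (α := ℝ) m) hb]
  have hp : 1 ≤ (m.centralBinom : ℝ) * α ^ m := by
    calc (1 : ℝ) ≤ (2 * α) ^ m := one_le_pow₀ (by linarith)
      _ = 2 ^ m * α ^ m := mul_pow _ _ _
      _ ≤ _ := by gcongr
  rw [← mul_assoc]
  exact le_mul_of_one_le_left (pow_nonneg (by linarith) m) hp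


/-- Theorem 3 instance (limited participation lower bound). Two alternatives
`A` (encoded `true`) and `B` (encoded `false`) at distance 1; `a` of the `n`
voters are located at `A` and the rest at `B`, with `α = a/n ∈ [1/2, 1)`.
Samples are tuples of `2k−2` voters drawn uniformly with replacement. Any
randomized mechanism which outputs `B` with probability at least `1/2` on every
balanced sample (exactly `k−1` sampled voters at `A` and `k−1` at `B`) has
expected k-th power of social cost at least `(1/2)(1−α)^{k−1} α^k`, and hence
normalized k-th moment of Distortion at least `α/(2(1−α)^{1/k})`. -/
theorem limited_participation_lower_bound
    (n k a : ℕ) (hn : 1 ≤ n) (hk : 1 ≤ k) (han : a ≤ n)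
    (α : ℝ) (hα : α = (a : ℝ) / n) (hhalf : 1 / 2 ≤ α) (h1 : α < 1)
    (loc : Fin n → Bool)
    (hcard : (Finset.univ.filter (fun i => loc i = true)).card = a)
    (SC : Bool → ℝ)
    (hSC : ∀ c, SC c = (1 / (n : ℝ)) * ∑ i, (if loc i = c then (0 : ℝ) else 1))
    (mech : (Fin (2 * k - 2) → Fin n) → Bool → ℝ)
    (hpos : ∀ s c, 0 ≤ mech s c)
    (hsum : ∀ s, ∑ c, mech s c = 1)
    (hbal : ∀ s : Fin (2 * k - 2) → Fin n,
      (Finset.univ.filter (fun j => loc (s j) = true)).card = k - 1 →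
      1 / 2 ≤ mech s false) :
    (1 / 2) * (1 - α) ^ (k - 1) * α ^ k ≤
      (1 / (n : ℝ) ^ (2 * k - 2)) *
        ∑ s : Fin (2 * k - 2) → Fin n, ∑ c, mech s c * SC c ^ k
    ∧ α / (2 * (1 - α) ^ ((1 : ℝ) / k)) ≤
      ((1 / (n : ℝ) ^ (2 * k - 2)) *
        ∑ s : Fin (2 * k - 2) → Fin n, ∑ c, mech s c * SC c ^ k) ^ ((1 : ℝ) / k)
        / SC true := by
  obtain ⟨m, rfl⟩ : ∃ m, k = m + 1 := ⟨k - 1, by omega⟩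
  have hN : 2 * (m + 1) - 2 = 2 * m := by omega
  have hn0 : (0 : ℝ) < n := by exact_mod_cast hn
  have hα0 : 0 < α := by linarith
  have hβ0 : 0 < 1 - α := by linarith
  have ha : (a : ℝ) = α * n := by rw [hα]; field_simp
  have hcardB : ((Finset.univ.filter (fun i => loc i = false)).card : ℝ) = (1 - α) * n := by
    have h := Finset.card_filter_add_card_filter_not (s := (Finset.univ : Finset (Fin n)))
      (fun i => loc i = true)
    simp only [Bool.not_eq_true, hcard, Finset.card_univ, Fintype.card_fin] at h
    have h' : (a : ℝ) + (Finset.univ.filter (fun i => loc i = false)).card = n := by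
      exact_mod_cast h
    linarith
  have hSCA : SC true = 1 - α := by
    have h : ∑ i, (if loc i = true then (0 : ℝ) else 1) =
        (Finset.univ.filter (fun i => loc i = false)).card := by
      rw [Finset.card_filter, Nat.cast_sum]
      refine Finset.sum_congr rfl fun i _ => ?_
      cases loc i <;> simp
    rw [hSC, h, hcardB]
    field_simp
  have hSCB : SC false = α := by
    have h : ∑ i, (if loc i = false then (0 : ℝ) else 1) =
        (Finset.univ.filter (fun i => loc i = true)).card := by
      rw [Finset.card_filter, Nat.cast_sum]
      refine Finset.sum_congr rfl fun i _ => ?_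
      cases loc i <;> simp
    rw [hSC, h, hcard, ha]
    field_simp
  have hmoment : (1 / 2) * (1 - α) ^ (m + 1 - 1) * α ^ (m + 1) ≤
      (1 / (n : ℝ) ^ (2 * (m + 1) - 2)) *
        ∑ s : Fin (2 * (m + 1) - 2) → Fin n, ∑ c, mech s c * SC c ^ (m + 1) := by
    have hcount : ((Finset.univ.filter (fun s : Fin (2 * (m + 1) - 2) → Fin n =>
        (Finset.univ.filter (fun j => loc (s j) = true)).card = m)).card : ℝ) =
        (m.centralBinom : ℝ) * (α ^ m * (1 - α) ^ m) * (n : ℝ) ^ (2 * (m + 1) - 2) := by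
      rw [card_filter_card_filter_eq, hcard, Fintype.card_fin, hN,
        show 2 * m - m = m by omega, ← Nat.centralBinom_eq_two_mul_choose]
      push_cast
      rw [hcardB, ha, mul_pow, mul_pow]
      ring
    have hlow : ((Finset.univ.filter (fun s : Fin (2 * (m + 1) - 2) → Fin n =>
        (Finset.univ.filter (fun j => loc (s j) = true)).card = m)).card : ℝ) *
          (1 / 2 * α ^ (m + 1)) ≤
        ∑ s : Fin (2 * (m + 1) - 2) → Fin n, ∑ c, mech s c * SC c ^ (m + 1) := by
      rw [← nsmul_eq_mul, ← Finset.sum_const, Finset.sum_filter]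
      refine Finset.sum_le_sum fun s _ => ?_
      rw [Fintype.sum_bool, hSCA, hSCB]
      have hA : 0 ≤ mech s true * (1 - α) ^ (m + 1) := mul_nonneg (hpos s true) (by positivity)
      split_ifs with h
      · have hB : 1 / 2 * α ^ (m + 1) ≤ mech s false * α ^ (m + 1) :=
          mul_le_mul_of_nonneg_right (hbal s h) (by positivity)
        linarith
      · exact add_nonneg hA (mul_nonneg (hpos s false) (by positivity))
    rw [hcount] at hlow
    rw [one_div_mul_eq_div ((n : ℝ) ^ _), le_div_iff₀ (by positivity), Nat.add_sub_cancel]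
    refine le_trans ?_ hlow
    calc 1 / 2 * (1 - α) ^ m * α ^ (m + 1) * (n : ℝ) ^ (2 * (m + 1) - 2)
        = (1 - α) ^ m * (n : ℝ) ^ (2 * (m + 1) - 2) * (1 / 2 * α ^ (m + 1)) := by ring
      _ ≤ _ := by
        gcongr
        exact one_sub_pow_le_centralBinom_mul hhalf h1.le m
  refine ⟨hmoment, ?_⟩
  rw [hSCA, le_div_iff₀ hβ0]
  have hq0 : 0 < (1 - α) ^ ((1 : ℝ) / (m + 1 : ℕ)) := Real.rpow_pos_of_pos hβ0 _
  have hqk : ((1 - α) ^ ((1 : ℝ) / (m + 1 : ℕ))) ^ (m + 1) = 1 - α := by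
    rw [one_div, Real.rpow_inv_natCast_pow hβ0.le (by omega)]
  set q := (1 - α) ^ ((1 : ℝ) / (m + 1 : ℕ))
  have hx0 : 0 ≤ α / (2 * q) * (1 - α) := by positivity
  have hxk : (α / (2 * q) * (1 - α)) ^ (m + 1) ≤
      (1 / 2) * (1 - α) ^ (m + 1 - 1) * α ^ (m + 1) := by
    rw [mul_pow, div_pow, mul_pow, hqk, Nat.add_sub_cancel]
    have h2 : (1 : ℝ) / 2 ^ (m + 1) ≤ 1 / 2 :=
      one_div_le_one_div_of_le two_pos (le_self_pow₀ one_le_two (by omega))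
    calc α ^ (m + 1) / (2 ^ (m + 1) * (1 - α)) * (1 - α) ^ (m + 1)
        = 1 / 2 ^ (m + 1) * (1 - α) ^ m * α ^ (m + 1) := by
          rw [pow_succ (1 - α) m]
          field_simp
      _ ≤ _ := by gcongr
  calc α / (2 * q) * (1 - α)
      = ((α / (2 * q) * (1 - α)) ^ (m + 1)) ^ ((1 : ℝ) / (m + 1 : ℕ)) := by
        rw [one_div, Real.pow_rpow_inv_natCast hx0 (by omega)]
    _ ≤ _ := Real.rpow_le_rpow (by positivity) (hxk.trans hmoment) (by positivity)
end

section
/- (Geometric core of Theorem 2: uncovered alternatives are close to the optimum.) Let (M, d) be a metric space, let n ≥ 3 voters have positions x_1, …, x_n ∈ M, and let a* ∈ M with μ = (1/n)·Σ_{i=1}^n d(x_i, a*) and ρ = 2·(1 + 1/(n−2))·μ. Say that "a majority of voters prefers S to T" when |{i : d(x_i, S) < d(x_i, T)}| ≥ n/2. Let X ≥ 0 and let p, a_m ∈ M with d(p, a*) ≤ X and d(p, a_m) ≤ X. Suppose W ∈ M satisfies: either (i) a majority of voters prefers W to a_m, or (ii) there exists W' ∈ M such that a majority of voters prefers W to W'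 and a majority of voters prefers W' to a_m. Then d(W, a*) ≤ 8·(1 + 1/(n−2))·μ + 2X. -/
/-- If a finite set `A` of indices satisfies `∑ i, f i ≤ #A * r` with `f ≥ 0`, then some `i ∈ A`
has `f i ≤ r`. -/
theorem Finset.exists_le_of_sum_univ_le_card_mul {ι : Type*} [Fintype ι] {f : ι → ℝ}
    (hf : ∀ i, 0 ≤ f i) {A : Finset ι} (hA : A.Nonempty) {r : ℝ}
    (h : ∑ i, f i ≤ A.card * r) : ∃ i ∈ A, f i ≤ r := by
  refine Finset.exists_le_of_sum_le hA ?_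
  rw [Finset.sum_const, nsmul_eq_mul]
  exact (Finset.sum_le_univ_sum_of_nonneg hf).trans h

/-- If a point of the ball of radius `r` around `a` is at least as close to `S` as to `T`, then
`S` is at most `2 * r` further from `a` than `T` is. -/
theorem dist_le_dist_add_two_mul_of_dist_le {M : Type*} [PseudoMetricSpace M] {v a S T : M} {r : ℝ}
    (hv : dist v a ≤ r) (hST : dist v S ≤ dist v T) : dist S a ≤ dist T a + 2 * r := by
  have h₁ := dist_triangle_left S a v
  have h₂ := dist_triangle_right v T a
  linarith

/-- Geometric core of Theorem 2: any alternative `W` that is uncovered relative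
to `a_m` under majority comparisons is within distance `8(1 + 1/(n−2))μ + 2X`
of `a*`, where `μ` is the average voter distance to `a*`, `p` is a point with
`d(p, a*) ≤ X` and `d(p, a_m) ≤ X`. "A majority of voters prefers S to T" means
at least `n/2` voters are strictly closer to `S` than to `T`. -/
theorem uncovered_close_to_opt
    {M : Type*} [MetricSpace M]
    (n : ℕ) (hn : 3 ≤ n) (x : Fin n → M) (astar : M)
    (μ : ℝ)
    (hμ : μ = (1 / (n : ℝ)) * ∑ i, dist (x i) astar)
    (maj : M → M → Prop)
    (hmaj : ∀ S T, maj S T ↔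
      (n : ℝ) / 2 ≤
        ((Finset.univ.filter (fun i => dist (x i) S < dist (x i) T)).card : ℝ))
    (X : ℝ) (hX : 0 ≤ X) (p am : M)
    (hpa : dist p astar ≤ X) (hpm : dist p am ≤ X)
    (W : M)
    (hW : maj W am ∨ ∃ W' : M, maj W W' ∧ maj W' am) :
    dist W astar ≤ 8 * (1 + 1 / ((n : ℝ) - 2)) * μ + 2 * X := by
  have hn' : (3 : ℝ) ≤ n := by exact_mod_cast hn
  have hsum : ∑ i, dist (x i) astar = n * μ := by
    rw [hμ]
    field_simp
  have hμ0 : 0 ≤ μ := by rw [hμ]; positivity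
  have hinv : 0 ≤ 1 / ((n : ℝ) - 2) := one_div_nonneg.mpr (by linarith)
  have hstep : ∀ S T, maj S T →
      dist S astar ≤ dist T astar + 2 * (2 * (1 + 1 / ((n : ℝ) - 2)) * μ) := by
    intro S T h
    rw [hmaj] at h
    obtain ⟨i, hi, hir⟩ := Finset.exists_le_of_sum_univ_le_card_mul
      (f := fun i => dist (x i) astar) (r := 2 * (1 + 1 / ((n : ℝ) - 2)) * μ)
      (fun _ => dist_nonneg)
      (Finset.card_pos.mp (Nat.cast_pos.mp ((by linarith : (0 : ℝ) < n / 2).trans_le h)))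
      (calc
        ∑ i, dist (x i) astar = (n : ℝ) / 2 * (2 * μ) := by rw [hsum]; ring
        _ ≤ _ := mul_le_mul h (by nlinarith [mul_nonneg hinv hμ0]) (by positivity)
          (Nat.cast_nonneg _))
    exact dist_le_dist_add_two_mul_of_dist_le hir (Finset.mem_filter.mp hi).2.le
  have ham : dist am astar ≤ 2 * X := by
    linarith [dist_triangle_left am astar p]
  have hρ := mul_nonneg hinv hμ0
  rcases hW with h | ⟨W', h₁, h₂⟩
  · linarith [hstep _ _ h]
  · linarith [hstep _ _ h₁, hstep _ _ h₂]
end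

section
/- (Geometric core of Theorem 4.) Let (M, d) be a metric space, let k ≥ 1, and let s_1, …, s_{2k−1} ∈ M be the positions of 2k−1 sampled voters with associated favorite alternatives f_1, …, f_{2k−1} ∈ M satisfying d(s_i, f_i) ≤ d(s_i, a*) for every i, where a* ∈ M is a fixed point. Let Y ≥ 0 and let B = {i : d(s_i, a*) ≤ Y}. If W ∈ M satisfies d(W, a*) > 4Y, then for all i, l ∈ B it holds that d(s_i, f_l) ≤ 3Y < d(s_i, W); in particular, every voter in B strictly prefers the favorite alternative of every voter in B to W. Consequently, if |B| ≥ k and W has the property that there is NO set J of k sampled voters such that every voter in J strictly prefers the favorite alternative of every member of J to W, then d(W, a*) ≤ 4Y. -/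
/-- Geometric core of Theorem 4. `s i` are positions of the `2k−1` sampled
voters, `f i` their favorite alternatives (so `d(s_i, f_i) ≤ d(s_i, a*)`),
`B` the set of sampled voters within distance `Y` of `a*`. If `d(W, a*) > 4Y`
then every voter in `B` strictly prefers the favorite of every voter in `B` to
`W` (indeed `d(s_i, f_l) ≤ 3Y < d(s_i, W)`); consequently, if `|B| ≥ k` and no
`k`-element set of sampled voters all strictly prefer each other's favorites to
`W`, then `d(W, a*) ≤ 4Y`. -/
theorem frc_geometric_core
    {M : Type*} [MetricSpace M]
    (k : ℕ) (hk : 1 ≤ k)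
    (s f : Fin (2 * k - 1) → M) (astar : M)
    (hfav : ∀ i, dist (s i) (f i) ≤ dist (s i) astar)
    (Y : ℝ) (hY : 0 ≤ Y)
    (B : Finset (Fin (2 * k - 1)))
    (hB : B = Finset.univ.filter (fun i => dist (s i) astar ≤ Y))
    (W : M) :
    (4 * Y < dist W astar →
      ∀ i ∈ B, ∀ l ∈ B, dist (s i) (f l) ≤ 3 * Y ∧ 3 * Y < dist (s i) W)
    ∧ (k ≤ B.card →
        (¬ ∃ J : Finset (Fin (2 * k - 1)), J.card = k ∧
          ∀ i ∈ J, ∀ l ∈ J, dist (s i) (f l) < dist (s i) W) →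
        dist W astar ≤ 4 * Y) := by
  have key : 4 * Y < dist W astar →
      ∀ i ∈ B, ∀ l ∈ B, dist (s i) (f l) ≤ 3 * Y ∧ 3 * Y < dist (s i) W := by
    intro hW i hi l hl
    simp only [hB, Finset.mem_filter, Finset.mem_univ, true_and] at hi hl
    constructor
    · have h := dist_triangle4 (s i) astar (s l) (f l)
      rw [dist_comm astar (s l)] at h
      linarith [hfav l]
    · have h := dist_triangle W (s i) astar
      rw [dist_comm W (s i)] at h
      linarith
  refine ⟨key, fun hcard hno => ?_⟩
  by_contra! hW
  obtain ⟨J, hJB, hJ⟩ := Finset.exists_subset_card_eq hcard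
  refine hno ⟨J, hJ, fun i hi l hl => ?_⟩
  obtain ⟨h₁, h₂⟩ := key hW i (hJB hi) l (hJB hl)
  exact h₁.trans_lt h₂
end

section
/- (Theorem 4, limited participation: FRC_{2k−1} has normalized k-th moment of Distortion at most 17.) Let (M, d) be a metric space, let n ≥ 1 voters have positions x_1, …, x_n ∈ M, let A ⊆ M be a finite nonempty set of alternatives, and let fav : {1,…,n} → A assign to each voter a favorite alternative, i.e., d(x_i, fav(i)) ≤ d(x_i, b) for all b ∈ A. Define the social cost SC(c) = (1/n)·Σ_{i=1}^n d(x_i, c) and let a* ∈ A minimize SC over A. Fix k ≥ 1. A sample is a tuple s ∈ {1,…,n}^{2k−1} (voters drawn uniformly with replacement), with elicited set E(s) = {fav(s_1), …, fav(s_{2k−1})}. Let W be any function assigning to each sample s an alternative W(s) ∈ E(s) such that there is NO k-element subset J ⊆ {1, …, 2k−1} of sample indices with the property that d(x_{s_i}, fav(s_l)) < d(x_{s_i}, W(s)) for all i, l ∈ J (i.e., no k sampled voters each strictly prefer the favorite alternative of every one of those k voters to W(s)). Then (1/n^{2k−1})·Σ_{s ∈ {1,…,n}^{2k−1}} SC(W(s))^k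 ≤ 17^k · SC(a*)^k. -/
open Finset in
/-- A tuple of `2k - 1` reals has a median `m`: `k` of its entries are at most `m` and `k` of them
are at least `m`. -/
theorem exists_median {k : ℕ} (hk : 1 ≤ k) (y : Fin (2 * k - 1) → ℝ) :
    ∃ j₀, (∃ J : Finset (Fin (2 * k - 1)), #J = k ∧ ∀ i ∈ J, y i ≤ y j₀) ∧
      ∃ T : Finset (Fin (2 * k - 1)), #T = k ∧ ∀ i ∈ T, y j₀ ≤ y i := by
  have hmono : Monotone (y ∘ Tuple.sort y) := Tuple.monotone_sort y
  let c : Fin (2 * k - 1) := ⟨k - 1, by omega⟩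
  refine ⟨Tuple.sort y c, ⟨(Iic c).map (Tuple.sort y).toEmbedding, ?_, ?_⟩,
    ⟨(Ici c).map (Tuple.sort y).toEmbedding, ?_, ?_⟩⟩
  · rw [card_map, Fin.card_Iic]
    simp only [c]
    omega
  · intro i hi
    obtain ⟨a, ha, rfl⟩ := mem_map.1 hi
    exact hmono (mem_Iic.1 ha)
  · rw [card_map, Fin.card_Ici]
    simp only [c]
    omega
  · intro i hi
    obtain ⟨a, ha, rfl⟩ := mem_map.1 hi
    exact hmono (mem_Ici.1 ha)

open Finset in
/-- Summing a product over the coordinates in `T` over all tuples. -/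
theorem sum_prod_coords {ι κ : Type*} [Fintype ι] [DecidableEq ι] [Fintype κ]
    (T : Finset ι) (r : κ → ℝ) :
    ∑ s : ι → κ, ∏ j ∈ T, r (s j) =
      (∑ i, r i) ^ #T * (Fintype.card κ : ℝ) ^ (Fintype.card ι - #T) := by
  have h := (prod_univ_sum (fun _ : ι => (univ : Finset κ))
    (fun j i => if j ∈ T then r i else (1 : ℝ))).symm
  rw [Fintype.piFinset_univ] at h
  have hl : ∀ s : ι → κ, ∏ j ∈ T, r (s j) = ∏ j, if j ∈ T then r (s j) else 1 := by
    intro s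
    rw [prod_ite_mem, univ_inter]
  simp_rw [hl]
  rw [h, ← prod_mul_prod_compl T, ← card_compl]
  congr 1
  · rw [← prod_const]
    exact prod_congr rfl fun j hj => by simp [hj]
  · rw [← prod_const]
    exact prod_congr rfl fun j hj => by simp [mem_compl.1 hj]

open Finset in
/-- The sum over all `(2k-1)`-tuples of the `k`-th elementary symmetric polynomial. -/
theorem sum_esymm_le {n k : ℕ} (hn : 1 ≤ n) (hk : 1 ≤ k) (r : Fin n → ℝ) (hr : ∀ i, 0 ≤ r i) :
    (1 / (n : ℝ) ^ (2 * k - 1)) * ∑ s : Fin (2 * k - 1) → Fin n,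
      ∑ T ∈ powersetCard k (univ : Finset (Fin (2 * k - 1))), ∏ j ∈ T, r (s j) ≤
      4 ^ k * ((1 / (n : ℝ)) * ∑ i, r i) ^ k := by
  have hn0 : (n : ℝ) ≠ 0 := by positivity
  have hS : 0 ≤ ∑ i, r i := sum_nonneg fun i _ => hr i
  rw [sum_comm]
  have hT : ∀ T ∈ powersetCard k (univ : Finset (Fin (2 * k - 1))),
      ∑ s : Fin (2 * k - 1) → Fin n, ∏ j ∈ T, r (s j) =
        (∑ i, r i) ^ k * (n : ℝ) ^ (2 * k - 1 - k) := by
    intro T hT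
    rw [sum_prod_coords, (mem_powersetCard.1 hT).2, Fintype.card_fin, Fintype.card_fin]
  rw [sum_congr rfl hT, sum_const, card_powersetCard, card_univ, Fintype.card_fin, nsmul_eq_mul]
  have hpow : (n : ℝ) ^ (2 * k - 1) = n ^ k * n ^ (2 * k - 1 - k) := by
    rw [← pow_add]
    congr 1
    omega
  have hchoose : ((2 * k - 1).choose k : ℝ) ≤ 4 ^ k := by
    have h : (2 * k - 1).choose k ≤ 4 ^ k :=
      (Nat.choose_le_two_pow _ _).trans <| by
        rw [show 4 = 2 ^ 2 from rfl, ← pow_mul]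
        exact Nat.pow_le_pow_right (by norm_num) (by omega)
    exact_mod_cast h
  calc _ = ((2 * k - 1).choose k : ℝ) * ((1 / (n : ℝ)) * ∑ i, r i) ^ k := by
        rw [hpow, mul_pow, div_pow, one_pow]
        field_simp
    _ ≤ _ := by gcongr

/-- Convexity of the `k`-th power, with the weights `1/17` and `16/17`. -/
theorem add_four_mul_pow_le (k : ℕ) {R m : ℝ} (hR : 0 ≤ R) (hm : 0 ≤ m) :
    (R + 4 * m) ^ k ≤ 1 / 17 * (17 * R) ^ k + 16 / 17 * (17 / 4 * m) ^ k := by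
  have h := (convexOn_pow k).2 (Set.mem_Ici.2 (by positivity : 0 ≤ 17 * R))
    (Set.mem_Ici.2 (by positivity : 0 ≤ 17 / 4 * m))
    (by norm_num : (0 : ℝ) ≤ 1 / 17) (by norm_num : (0 : ℝ) ≤ 16 / 17) (by norm_num)
  simp only [smul_eq_mul] at h
  rwa [show 1 / 17 * (17 * R) + 16 / 17 * (17 / 4 * m) = R + 4 * m by ring] at h


/-- Theorem 4 (limited participation): the `FRC_{2k−1}` mechanism — sample
`2k−1` voters uniformly with replacement, elicit their favorite alternatives,
and select any elicited alternative `W(s)` such that no `k` sampled voters each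
strictly prefer the favorite of every one of those `k` voters to `W(s)` (as any
Copeland winner among the sampled voters does) — has normalized k-th moment of
Distortion at most `17`. -/
theorem frc_kth_moment_distortion
    {M : Type*} [MetricSpace M] [DecidableEq M]
    (n k : ℕ) (hn : 1 ≤ n) (hk : 1 ≤ k)
    (x : Fin n → M) (A : Finset M) (hA : A.Nonempty)
    (fav : Fin n → M)
    (hfavA : ∀ i, fav i ∈ A)
    (hfav : ∀ i, ∀ b ∈ A, dist (x i) (fav i) ≤ dist (x i) b)
    (SC : M → ℝ)
    (hSC : ∀ c, SC c = (1 / (n : ℝ)) * ∑ i, dist (x i) c)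
    (astar : M) (hastar : astar ∈ A)
    (hopt : ∀ b ∈ A, SC astar ≤ SC b)
    (E : (Fin (2 * k - 1) → Fin n) → Finset M)
    (hE : ∀ s, E s = Finset.univ.image (fun j => fav (s j)))
    (W : (Fin (2 * k - 1) → Fin n) → M)
    (hWmem : ∀ s, W s ∈ E s)
    (hWno : ∀ s, ¬ ∃ J : Finset (Fin (2 * k - 1)), J.card = k ∧
      ∀ i ∈ J, ∀ l ∈ J, dist (x (s i)) (fav (s l)) < dist (x (s i)) (W s)) :
    (1 / (n : ℝ) ^ (2 * k - 1)) *
        ∑ s : Fin (2 * k - 1) → Fin n, SC (W s) ^ k ≤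
      17 ^ k * SC astar ^ k := by
  classical
  have hn0 : (n : ℝ) ≠ 0 := by positivity
  set r : Fin n → ℝ := fun i => dist (x i) astar with hr
  have hr0 : ∀ i, 0 ≤ r i := fun i => dist_nonneg
  have hSC0 : ∀ c, 0 ≤ SC c := fun c => by
    rw [hSC]
    exact mul_nonneg (by positivity) (Finset.sum_nonneg fun i _ => dist_nonneg)
  have hlip : ∀ c, SC c ≤ SC astar + dist c astar := by
    intro c
    have h : ∑ i, dist (x i) c ≤ ∑ i, (dist (x i) astar + dist c astar) :=
      Finset.sum_le_sum fun i _ => dist_triangle_right _ _ _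
    rw [Finset.sum_add_distrib, Finset.sum_const, Finset.card_univ, Fintype.card_fin,
      nsmul_eq_mul] at h
    rw [hSC c, hSC astar]
    calc _ ≤ 1 / (n : ℝ) * (∑ i, dist (x i) astar + n * dist c astar) := by gcongr
      _ = _ := by field_simp
  have hpt : ∀ s, SC (W s) ^ k ≤ 1 / 17 * (17 * SC astar) ^ k + 16 / 17 * (17 / 4) ^ k *
      ∑ T ∈ Finset.powersetCard k (Finset.univ : Finset (Fin (2 * k - 1))),
        ∏ j ∈ T, r (s j) := by
    intro s
    obtain ⟨j₀, ⟨J, hJ, hJle⟩, T, hT, hTle⟩ := exists_median hk fun j => r (s j)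
    have hW : dist (W s) astar ≤ 4 * r (s j₀) := by
      have h := hWno s
      push Not at h
      obtain ⟨i, hi, l, hl, hil⟩ := h J hJ
      have h₁ := hJle i hi
      have h₂ := hJle l hl
      have h₃ := hfav (s l) astar hastar
      have h₄ := dist_triangle_left (W s) astar (x (s i))
      have h₅ := dist_triangle (x (s i)) astar (fav (s l))
      have h₆ := dist_triangle_left astar (fav (s l)) (x (s l))
      simp only [hr] at h₁ h₂ ⊢
      linarith
    have hprod : r (s j₀) ^ k ≤ ∑ T ∈ Finset.powersetCard k
        (Finset.univ : Finset (Fin (2 * k - 1))), ∏ j ∈ T, r (s j) := by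
      calc r (s j₀) ^ k = ∏ _j ∈ T, r (s j₀) := by rw [Finset.prod_const, hT]
        _ ≤ ∏ j ∈ T, r (s j) := Finset.prod_le_prod (fun _ _ => hr0 _) hTle
        _ ≤ _ := Finset.single_le_sum (f := fun T => ∏ j ∈ T, r (s j))
            (fun T _ => Finset.prod_nonneg fun j _ => hr0 _)
            (Finset.mem_powersetCard.2 ⟨Finset.subset_univ T, hT⟩)
    calc SC (W s) ^ k ≤ (SC astar + 4 * r (s j₀)) ^ k :=
          pow_le_pow_left₀ (hSC0 _) (by linarith [hlip (W s)]) k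
      _ ≤ 1 / 17 * (17 * SC astar) ^ k + 16 / 17 * (17 / 4 * r (s j₀)) ^ k :=
          add_four_mul_pow_le k (hSC0 _) (hr0 _)
      _ = 1 / 17 * (17 * SC astar) ^ k + 16 / 17 * (17 / 4) ^ k * r (s j₀) ^ k := by
          rw [mul_pow (17 / 4 : ℝ), mul_assoc]
      _ ≤ _ := by gcongr
  have hmoment := sum_esymm_le hn hk r hr0
  rw [show 1 / (n : ℝ) * ∑ i, r i = SC astar from (hSC astar).symm] at hmoment
  set Q : ℝ := ∑ s : Fin (2 * k - 1) → Fin n,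
    ∑ T ∈ Finset.powersetCard k (Finset.univ : Finset (Fin (2 * k - 1))), ∏ j ∈ T, r (s j)
  calc _ ≤ 1 / (n : ℝ) ^ (2 * k - 1) * ((n : ℝ) ^ (2 * k - 1) *
        (1 / 17 * (17 * SC astar) ^ k) + 16 / 17 * (17 / 4) ^ k * Q) := by
        gcongr
        refine (Finset.sum_le_sum fun s _ => hpt s).trans_eq ?_
        rw [Finset.sum_add_distrib, Finset.sum_const, ← Finset.mul_sum, Finset.card_univ,
          Fintype.card_fun, Fintype.card_fin, Fintype.card_fin, nsmul_eq_mul, Nat.cast_pow]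
    _ = 1 / 17 * (17 * SC astar) ^ k +
        16 / 17 * (17 / 4) ^ k * (1 / (n : ℝ) ^ (2 * k - 1) * Q) := by
        field_simp
    _ ≤ 1 / 17 * (17 * SC astar) ^ k + 16 / 17 * (17 / 4) ^ k * (4 ^ k * SC astar ^ k) := by
        gcongr
    _ = 17 ^ k * SC astar ^ k := by
        rw [mul_assoc (16 / 17 : ℝ), ← mul_assoc ((17 / 4 : ℝ) ^ k), ← mul_pow (17 / 4 : ℝ),
          mul_pow]
        norm_num
        ring
end

section
/- (Corollary 2, high-probability form of Theorem 4.) Under the hypotheses of Theorem 4 — i.e., (M, d) a metric space, n ≥ 1 voters at x_1, …, x_n ∈ M, finite nonempty alternative set A ⊆ M with favorite map fav, social cost SC(c) = (1/n)·Σ_i d(x_i, c) minimized over A by a*, k ≥ 1, samples s ∈ {1,…,n}^{2k−1} uniform, and any winner map W with W(s) ∈ E(s) = {fav(s_1),…,fav(s_{2k−1})} such that no k-element subset J of sample indices satisfies d(x_{s_i}, fav(s_l)) < d(x_{s_i}, W(s)) for all i, l ∈ J — for every real c > 0, the fraction of samples s ∈ {1,…,n}^{2k−1} for which SC(W(s))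 > c · SC(a*) is at most (17/c)^k. -/
/-- The number of tuples having at least `k` entries in `B`, by a union bound over the
`k`-element sets of positions. -/
theorem card_filter_exists_forall_mem_le {ι α : Type*} [Fintype ι] [DecidableEq ι] [Fintype α]
    [DecidableEq α] (B : Finset α) (k : ℕ) (S : Finset (ι → α))
    (hS : ∀ s ∈ S, ∃ J : Finset ι, J.card = k ∧ ∀ i ∈ J, s i ∈ B) :
    S.card ≤ (Fintype.card ι).choose k *
      (B.card ^ k * Fintype.card α ^ (Fintype.card ι - k)) := by
  have hsub : S ⊆ (Finset.powersetCard k (Finset.univ : Finset ι)).biUnion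
      fun J => Fintype.piFinset fun i => if i ∈ J then B else Finset.univ := by
    intro s hs
    obtain ⟨J, hJ, hJB⟩ := hS s hs
    simp only [Finset.mem_biUnion, Finset.mem_powersetCard, Fintype.mem_piFinset]
    refine ⟨J, ⟨Finset.subset_univ _, hJ⟩, fun i => ?_⟩
    split_ifs with h
    · exact hJB i h
    · exact Finset.mem_univ _
  refine (Finset.card_le_card hsub).trans ?_
  refine (Finset.card_biUnion_le_card_mul _ _
    (B.card ^ k * Fintype.card α ^ (Fintype.card ι - k)) ?_).trans ?_
  · intro J hJ
    obtain ⟨-, hJ⟩ := Finset.mem_powersetCard.1 hJ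
    have hcard : ∀ i, (if i ∈ J then B else Finset.univ).card =
        if i ∈ J then B.card else Fintype.card α := by
      intro i
      split_ifs <;> simp
    rw [Fintype.card_piFinset, Finset.prod_congr rfl fun i _ => hcard i, Finset.prod_ite,
      Finset.prod_const, Finset.prod_const, Finset.filter_not, Finset.filter_mem_eq_inter,
      Finset.univ_inter, ← Finset.compl_eq_univ_sdiff, Finset.card_compl, hJ]
  · rw [Finset.card_powersetCard, Finset.card_univ]

/-- Markov's inequality for the uniform distribution on a finite set, at a multiple of the mean. -/
theorem card_filter_mul_le_card {α : Type*} [Fintype α] (D : α → ℝ) (hD : ∀ i, 0 ≤ D i)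
    (m a : ℝ) (hm : Fintype.card α * m = ∑ i, D i) (hm0 : 0 ≤ m) :
    ((Finset.univ.filter fun i => a * m < D i).card : ℝ) * a ≤ Fintype.card α := by
  set B := Finset.univ.filter fun i => a * m < D i with hB
  have hle : (B.card : ℝ) * (a * m) ≤ ∑ i, D i := by
    calc (B.card : ℝ) * (a * m) = ∑ _i ∈ B, a * m := by rw [Finset.sum_const, nsmul_eq_mul]
      _ ≤ ∑ i ∈ B, D i := Finset.sum_le_sum fun i hi => (Finset.mem_filter.1 hi).2.le
      _ ≤ ∑ i, D i :=
        Finset.sum_le_sum_of_subset_of_nonneg (Finset.subset_univ _) fun i _ _ => hD i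
  rcases hm0.eq_or_lt with h0 | hpos
  · have hzero : ∀ i ∈ Finset.univ, D i = 0 := by
      rw [← Finset.sum_eq_zero_iff_of_nonneg fun i _ => hD i, ← hm, ← h0, mul_zero]
    have hBe : B = ∅ := Finset.filter_eq_empty_iff.2 fun i hi => by
      rw [hzero i hi, ← h0]; simp
    simp [hBe]
  · rw [← hm] at hle
    exact le_of_mul_le_mul_right (by linarith) hpos

/-- Corollary 2 (high-probability form of Theorem 4): under the hypotheses of
Theorem 4, for every `c > 0` the fraction of samples `s ∈ {1,…,n}^{2k−1}` with
`SC(W(s)) > c · SC(a*)` is at most `(17/c)^k`. -/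
theorem frc_high_probability
    {M : Type*} [MetricSpace M] [DecidableEq M]
    (n k : ℕ) (hn : 1 ≤ n) (hk : 1 ≤ k)
    (x : Fin n → M) (A : Finset M) (hA : A.Nonempty)
    (fav : Fin n → M)
    (hfavA : ∀ i, fav i ∈ A)
    (hfav : ∀ i, ∀ b ∈ A, dist (x i) (fav i) ≤ dist (x i) b)
    (SC : M → ℝ)
    (hSC : ∀ c, SC c = (1 / (n : ℝ)) * ∑ i, dist (x i) c)
    (astar : M) (hastar : astar ∈ A)
    (hopt : ∀ b ∈ A, SC astar ≤ SC b)
    (E : (Fin (2 * k - 1) → Fin n) → Finset M)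
    (hE : ∀ s, E s = Finset.univ.image (fun j => fav (s j)))
    (W : (Fin (2 * k - 1) → Fin n) → M)
    (hWmem : ∀ s, W s ∈ E s)
    (hWno : ∀ s, ¬ ∃ J : Finset (Fin (2 * k - 1)), J.card = k ∧
      ∀ i ∈ J, ∀ l ∈ J, dist (x (s i)) (fav (s l)) < dist (x (s i)) (W s))
    (c : ℝ) (hc : 0 < c) :
    ((Finset.univ.filter
        (fun s : Fin (2 * k - 1) → Fin n => c * SC astar < SC (W s))).card : ℝ)
        / (n : ℝ) ^ (2 * k - 1) ≤
      (17 / c) ^ k := by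
  have hn0 : (0 : ℝ) < n := by exact_mod_cast hn
  rcases le_or_gt c 17 with hc17 | hc17
  · have hone : (1 : ℝ) ≤ (17 / c) ^ k := one_le_pow₀ ((one_le_div hc).2 hc17)
    refine le_trans ((div_le_one (by positivity)).2 ?_) hone
    have hcard := Finset.card_le_univ
      (Finset.univ.filter fun s : Fin (2 * k - 1) → Fin n => c * SC astar < SC (W s))
    rw [Fintype.card_fun, Fintype.card_fin, Fintype.card_fin] at hcard
    exact_mod_cast hcard
  have hmean : ∀ b, (n : ℝ) * SC b = ∑ i, dist (x i) b := by
    intro b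
    rw [hSC]
    field_simp
  have hSC0 : 0 ≤ SC astar := by
    rw [hSC]
    positivity
  have hSCle : ∀ b, SC b ≤ SC astar + dist astar b := by
    intro b
    refine le_of_mul_le_mul_left ?_ hn0
    rw [mul_add, hmean, hmean]
    calc ∑ i, dist (x i) b ≤ ∑ i, (dist (x i) astar + dist astar b) :=
          Finset.sum_le_sum fun i _ => dist_triangle _ _ _
      _ = _ := by simp [Finset.sum_add_distrib]
  set B : Finset (Fin n) :=
    Finset.univ.filter fun i => (c - 1) / 4 * SC astar < dist (x i) astar with hB
  have hBcard : (B.card : ℝ) * ((c - 1) / 4) ≤ n := by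
    have h := card_filter_mul_le_card (fun i => dist (x i) astar) (fun _ => dist_nonneg)
      (SC astar) ((c - 1) / 4) (by rw [Fintype.card_fin, hmean]) hSC0
    rwa [Fintype.card_fin] at h
  have hcount := card_filter_exists_forall_mem_le B k
    (Finset.univ.filter fun s : Fin (2 * k - 1) → Fin n => c * SC astar < SC (W s)) (by
      intro s hs
      have hs := (Finset.mem_filter.1 hs).2
      by_contra hnone
      have hfew : (Finset.univ.filter fun i => s i ∈ B).card < k := by
        by_contra! hge
        obtain ⟨J, hJ, hJk⟩ := Finset.exists_subset_card_eq hge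
        exact hnone ⟨J, hJk, fun i hi => (Finset.mem_filter.1 (hJ hi)).2⟩
      have hmany : k ≤ (Finset.univ.filter fun i => s i ∉ B).card := by
        have := Finset.card_filter_add_card_filter_not (s := Finset.univ) fun i => s i ∈ B
        rw [Finset.card_univ, Fintype.card_fin] at this
        omega
      obtain ⟨J, hJ, hJk⟩ := Finset.exists_subset_card_eq hmany
      have hnear : ∀ i ∈ J, dist (x (s i)) astar ≤ (c - 1) / 4 * SC astar := by
        intro i hi
        have := (Finset.mem_filter.1 (hJ hi)).2
        simpa [hB] using this
      refine hWno s ⟨J, hJk, fun i hi l hl => ?_⟩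
      have h1 := hnear i hi
      have h2 := hnear l hl
      have h3 := hfav (s l) astar hastar
      have h4 := hSCle (W s)
      have h5 := dist_triangle_left astar (W s) (x (s i))
      have h6 := dist_triangle4 (x (s i)) astar (x (s l)) (fav (s l))
      rw [dist_comm astar (x (s l))] at h6
      linarith)
  rw [Fintype.card_fin, Fintype.card_fin] at hcount
  have hchoose : (2 * k - 1).choose k ≤ 4 ^ k :=
    (Nat.choose_le_two_pow _ _).trans <| by
      rw [show (4 : ℕ) = 2 ^ 2 from rfl, ← pow_mul]
      exact Nat.pow_le_pow_right two_pos (Nat.sub_le _ _)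
  have hcount' := hcount.trans (Nat.mul_le_mul_right _ hchoose)
  rw [div_le_iff₀ (by positivity)]
  have hfrac : 4 * (B.card : ℝ) ≤ 17 / c * n := by
    have h1 : 4 * (B.card : ℝ) * (c - 1) ≤ 16 * n := by linarith
    have h2 : 4 * (B.card : ℝ) ≤ 16 * n / (c - 1) := (le_div_iff₀ (by linarith)).2 h1
    refine h2.trans ?_
    rw [div_mul_eq_mul_div, div_le_div_iff₀ (by linarith) hc]
    nlinarith
  calc _ ≤ (4 : ℝ) ^ k * ((B.card : ℝ) ^ k * (n : ℝ) ^ (2 * k - 1 - k)) := by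
        exact_mod_cast hcount'
    _ = (4 * (B.card : ℝ)) ^ k * (n : ℝ) ^ (2 * k - 1 - k) := by rw [mul_pow, mul_assoc]
    _ ≤ (17 / c * n) ^ k * (n : ℝ) ^ (2 * k - 1 - k) := by gcongr
    _ = (17 / c) ^ k * (n : ℝ) ^ (2 * k - 1) := by
        rw [mul_pow, mul_assoc, ← pow_add]
        congr 2
        omega
end
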